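/- arXiv:2508.01993 — 2 statements merged into one kernel-verified Lean document; each statement's English description precedes it below -/
import Mathlib

section
/- For all weights x, y > 0, the weighted connective constant of self-avoiding walks on the square lattice satisfies μ(x,y) ≤ 2^{−1/3}·[x³ + 12xy(x + y) + y³ + √(x⁶ + 24x⁵y + 136x⁴y² + 254x³y³ + 136x²y⁴ + 24xy⁵ + y⁶)]^{1/3}. -/
open scoped BigOperators

def sqStep : Fin 4 → ℤ × ℤ
  | 0 => (1, 0)
  | 1 => (-1, 0)
  | 2 => (0, 1)
  | 3 => (0, -1)

/-- Position of the walk after `i` steps, starting at the origin. -/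
def sqPos {n : ℕ} (ω : Fin n → Fin 4) (i : Fin (n + 1)) : ℤ × ℤ :=
  ∑ j : Fin n, if (j : ℕ) < (i : ℕ) then sqStep (ω j) else 0

/-- A walk is self-avoiding if its vertices are pairwise distinct. -/
def sqIsSAW {n : ℕ} (ω : Fin n → Fin 4) : Prop :=
  Function.Injective (sqPos ω)

/-- Number of horizontal steps. -/
def sqNh {n : ℕ} (ω : Fin n → Fin 4) : ℕ :=
  (Finset.univ.filter fun j => ω j = 0 ∨ ω j = 1).card

/-- Number of vertical steps. -/
def sqNv {n : ℕ} (ω : Fin n → Fin 4) : ℕ :=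
  (Finset.univ.filter fun j => ω j = 2 ∨ ω j = 3).card

/-- Weight `x^{N_h} y^{N_v}` of a walk. -/
noncomputable def sqWeight (x y : ℝ) {n : ℕ} (ω : Fin n → Fin 4) : ℝ :=
  x ^ sqNh ω * y ^ sqNv ω

/- `sawCount n x y` is `c_n(x,y)`: the sum of the weights of all `n`-step
self-avoiding walks starting at the origin. -/
open Classical in
noncomputable def sawCount (n : ℕ) (x y : ℝ) : ℝ :=
  ∑ ω ∈ Finset.univ.filter (fun ω : Fin n → Fin 4 => sqIsSAW ω), sqWeight x y ω

/-- The weighted connective constant `μ(x,y) = inf_{n ≥ 1} c_n(x,y)^{1/n}`. -/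
noncomputable def sawMu (x y : ℝ) : ℝ :=
  ⨅ n : ℕ, sawCount (n + 1) x y ^ (1 / (n + 1 : ℝ))

open Filter Topology

/-- The weight of a single step: `x` if it is horizontal and `y` if it is vertical. -/
def stepWeight (x y : ℝ) : Fin 4 → ℝ := ![x, x, y, y]

lemma sqWeight_eq_prod (x y : ℝ) {n : ℕ} (ω : Fin n → Fin 4) :
    sqWeight x y ω = ∏ j, stepWeight x y (ω j) := by
  have h : ∀ a : Fin 4, stepWeight x y a =
      (if a = 0 ∨ a = 1 then x else 1) * (if a = 2 ∨ a = 3 then y else 1) := by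
    intro a
    fin_cases a <;> simp [stepWeight]
  simp only [h, sqWeight, sqNh, sqNv, Finset.prod_mul_distrib, Finset.prod_ite,
    Finset.prod_const, one_pow, mul_one]

lemma sqPos_zero {n : ℕ} (ω : Fin n → Fin 4) : sqPos ω 0 = 0 := by
  simp [sqPos]

lemma sqPos_cons_succ {n : ℕ} (a : Fin 4) (ω : Fin n → Fin 4) (i : Fin (n + 1)) :
    sqPos (Fin.cons a ω : Fin (n + 1) → Fin 4) i.succ = sqStep a + sqPos ω i := by
  simp only [sqPos, Fin.sum_univ_succ, Fin.cons_zero, Fin.cons_succ, Fin.val_succ, Fin.val_zero,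
    Nat.succ_pos, if_true, Nat.add_lt_add_iff_right]

lemma sqIsSAW.of_cons {n : ℕ} {a : Fin 4} {ω : Fin n → Fin 4}
    (h : sqIsSAW (Fin.cons a ω : Fin (n + 1) → Fin 4)) : sqIsSAW ω := by
  intro i j hij
  apply Fin.succ_injective
  apply h
  rw [sqPos_cons_succ, sqPos_cons_succ, hij]

lemma sqIsSAW.sqStep_add_sqPos_ne_zero {n : ℕ} {a : Fin 4} {ω : Fin n → Fin 4}
    (h : sqIsSAW (Fin.cons a ω : Fin (n + 1) → Fin 4)) (i : Fin (n + 1)) :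
    sqStep a + sqPos ω i ≠ 0 := by
  intro h0
  rw [← sqPos_cons_succ, ← sqPos_zero (Fin.cons a ω : Fin (n + 1) → Fin 4)] at h0
  exact Fin.succ_ne_zero i (h h0)

/-- Four consecutive steps with no immediate reversal that do not close up to a unit square. -/
def IsOpenQuad (b c d a : Fin 4) : Prop :=
  sqStep b + sqStep c ≠ 0 ∧ sqStep c + sqStep d ≠ 0 ∧ sqStep d + sqStep a ≠ 0 ∧
    sqStep b + (sqStep c + (sqStep d + sqStep a)) ≠ 0

instance (b c d a : Fin 4) : Decidable (IsOpenQuad b c d a) := by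
  unfold IsOpenQuad
  infer_instance

lemma sqPos_one {n : ℕ} (ω : Fin (n + 1) → Fin 4) : sqPos ω 1 = sqStep (ω 0) := by
  conv_lhs => rw [← Fin.cons_self_tail ω, ← Fin.succ_zero_eq_one, sqPos_cons_succ, sqPos_zero]
  simp

lemma sqIsSAW.isOpenQuad {n : ℕ} {b c d : Fin 4} {ω : Fin (n + 1) → Fin 4}
    (h : sqIsSAW (Fin.cons b (Fin.cons c (Fin.cons d ω : Fin (n + 2) → Fin 4) :
      Fin (n + 3) → Fin 4) : Fin (n + 4) → Fin 4)) : IsOpenQuad b c d (ω 0) := by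
  refine ⟨?_, ?_, ?_, ?_⟩
  · simpa only [sqPos_one, Fin.cons_zero] using h.sqStep_add_sqPos_ne_zero 1
  · simpa only [sqPos_one, Fin.cons_zero] using h.of_cons.sqStep_add_sqPos_ne_zero 1
  · simpa only [sqPos_one] using h.of_cons.of_cons.sqStep_add_sqPos_ne_zero 1
  · simpa only [sqPos_cons_succ, sqPos_one] using
      h.sqStep_add_sqPos_ne_zero (1 : Fin (n + 2)).succ.succ

open Classical in
/-- The weighted count of self-avoiding walks in which each walk carries an additional factor
depending on its first step. -/
noncomputable def tiltedCount (x y : ℝ) (f : Fin 4 → ℝ) (n : ℕ) : ℝ :=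
  ∑ ω : Fin (n + 1) → Fin 4,
    if sqIsSAW ω then (∏ j, stepWeight x y (ω j)) * f (ω 0) else 0

lemma sum_fin_succ_fun {n : ℕ} {M : Type*} [AddCommMonoid M] (F : (Fin (n + 1) → Fin 4) → M) :
    ∑ ω, F ω = ∑ ω : Fin n → Fin 4, ∑ a, F (Fin.cons a ω) := by
  rw [← (Fin.consEquiv fun _ : Fin (n + 1) => Fin 4).sum_comp, Fintype.sum_prod_type_right]
  rfl

lemma stepWeight_pos {x y : ℝ} (hx : 0 < x) (hy : 0 < y) (a : Fin 4) :
    0 < stepWeight x y a := by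
  fin_cases a <;> simp [stepWeight, hx, hy]

lemma tiltedCount_add_three_le {x y l : ℝ} (hx : 0 < x) (hy : 0 < y) {f : Fin 4 → ℝ}
    (hf : ∀ a, 0 ≤ f a)
    (hl : ∀ a, ∑ d, ∑ c, ∑ b, (if IsOpenQuad b c d a then
      stepWeight x y b * stepWeight x y c * stepWeight x y d * f b else 0) ≤ l * f a) (n : ℕ) :
    tiltedCount x y f (n + 3) ≤ l * tiltedCount x y f n := by
  classical
  have hw : ∀ a, 0 < stepWeight x y a := stepWeight_pos hx hy
  unfold tiltedCount
  rw [sum_fin_succ_fun, sum_fin_succ_fun, sum_fin_succ_fun, Finset.mul_sum]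
  refine Finset.sum_le_sum fun ω _ => ?_
  by_cases hω : sqIsSAW ω
  · rw [if_pos hω]
    have hP : 0 ≤ ∏ j, stepWeight x y (ω j) := Finset.prod_nonneg fun j _ => (hw _).le
    calc _ ≤ ∑ d, ∑ c, ∑ b, (∏ j, stepWeight x y (ω j)) * (if IsOpenQuad b c d (ω 0) then
            stepWeight x y b * stepWeight x y c * stepWeight x y d * f b else 0) := by
          refine Finset.sum_le_sum fun d _ => Finset.sum_le_sum fun c _ =>
            Finset.sum_le_sum fun b _ => ?_
          split_ifs with h₁ h₂
          · apply le_of_eq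
            simp only [Fin.prod_univ_succ (n := n + 3), Fin.prod_univ_succ (n := n + 2),
              Fin.prod_univ_succ (n := n + 1), Fin.cons_zero, Fin.cons_succ]
            ring
          · exact absurd h₁.isOpenQuad h₂
          · have := hw b
            have := hw c
            have := hw d
            have := hf b
            positivity
          · simp
      _ = (∏ j, stepWeight x y (ω j)) * ∑ d, ∑ c, ∑ b, (if IsOpenQuad b c d (ω 0) then
            stepWeight x y b * stepWeight x y c * stepWeight x y d * f b else 0) := by
          simp only [Finset.mul_sum]
      _ ≤ (∏ j, stepWeight x y (ω j)) * (l * f (ω 0)) := by gcongr; exact hl _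
      _ = _ := by ring
  · rw [if_neg hω, mul_zero]
    refine le_of_eq (Finset.sum_eq_zero fun d _ => Finset.sum_eq_zero fun c _ =>
      Finset.sum_eq_zero fun b _ => if_neg fun h => hω h.of_cons.of_cons.of_cons)

lemma sawCount_nonneg {x y : ℝ} (hx : 0 < x) (hy : 0 < y) (n : ℕ) : 0 ≤ sawCount n x y :=
  Finset.sum_nonneg fun ω _ => by unfold sqWeight; positivity

lemma mul_sawCount_le_tiltedCount {x y m : ℝ} (hx : 0 < x) (hy : 0 < y) {f : Fin 4 → ℝ}
    (hm : ∀ a, m ≤ f a) (n : ℕ) : m * sawCount (n + 1) x y ≤ tiltedCount x y f n := by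
  classical
  unfold sawCount tiltedCount
  rw [Finset.sum_filter, Finset.mul_sum]
  refine Finset.sum_le_sum fun ω _ => ?_
  split_ifs
  · rw [sqWeight_eq_prod, mul_comm]
    have hP : 0 ≤ ∏ j, stepWeight x y (ω j) :=
      Finset.prod_nonneg fun j _ => (stepWeight_pos hx hy _).le
    gcongr
    exact hm _
  · simp

/-- A positive supersolution of the eigenvalue equation for three-step extensions bounds the
connective constant. -/
lemma sawMu_le_of_supersolution {x y l : ℝ} (hx : 0 < x) (hy : 0 < y) (hl0 : 0 < l)
    {f : Fin 4 → ℝ} (hf : ∀ a, 0 < f a)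
    (hl : ∀ a, ∑ d, ∑ c, ∑ b, (if IsOpenQuad b c d a then
      stepWeight x y b * stepWeight x y c * stepWeight x y d * f b else 0) ≤ l * f a) :
    sawMu x y ≤ l ^ (1 / 3 : ℝ) := by
  obtain ⟨a₀, ha₀⟩ := Finite.exists_min f
  set T := tiltedCount x y f 0 with hT
  have hT0 : 0 ≤ T := (mul_nonneg (hf a₀).le (sawCount_nonneg hx hy _)).trans
    (mul_sawCount_le_tiltedCount hx hy ha₀ 0)
  have hiter : ∀ k : ℕ, tiltedCount x y f (3 * k) ≤ l ^ k * T := by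
    intro k
    induction k with
    | zero => simp [hT]
    | succ k ih =>
      calc tiltedCount x y f (3 * k + 3)
          ≤ l * tiltedCount x y f (3 * k) :=
            tiltedCount_add_three_le hx hy (fun a => (hf a).le) hl _
        _ ≤ l * (l ^ k * T) := by gcongr
        _ = _ := by ring
  set C := T / f a₀ + 1 with hC
  have hCpos : 0 < C := by have := hf a₀; positivity
  have hcount : ∀ k : ℕ, sawCount (3 * k + 1) x y ≤ C * l ^ k := by
    intro k
    have h := (mul_sawCount_le_tiltedCount hx hy ha₀ (3 * k)).trans (hiter k)
    rw [← le_div_iff₀' (hf a₀)] at h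
    refine h.trans ?_
    have : 0 < l ^ k := by positivity
    calc l ^ k * T / f a₀ = T / f a₀ * l ^ k := by ring
      _ ≤ C * l ^ k := by rw [hC]; gcongr; linarith
  have hbdd : BddBelow (Set.range fun n : ℕ => sawCount (n + 1) x y ^ (1 / (n + 1 : ℝ))) :=
    ⟨0, by rintro _ ⟨n, rfl⟩; exact Real.rpow_nonneg (sawCount_nonneg hx hy _) _⟩
  have hle : ∀ k : ℕ, sawMu x y ≤
      C ^ (1 / (3 * k + 1 : ℝ)) * l ^ (1 / 3 - 1 / 3 * (1 / (3 * k + 1 : ℝ))) := by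
    intro k
    refine (ciInf_le hbdd (3 * k)).trans ?_
    have hk : (0 : ℝ) < 3 * k + 1 := by positivity
    push_cast
    calc _ ≤ (C * l ^ k) ^ (1 / (3 * k + 1 : ℝ)) :=
          Real.rpow_le_rpow (sawCount_nonneg hx hy _) (hcount k) (by positivity)
      _ = _ := by
          rw [Real.mul_rpow hCpos.le (by positivity), ← Real.rpow_natCast l k,
            ← Real.rpow_mul hl0.le]
          congr 2
          field_simp
          ring
  have hlim : Tendsto (fun k : ℕ => 1 / (3 * k + 1 : ℝ)) atTop (𝓝 0) := by
    simp only [one_div]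
    apply Tendsto.inv_tendsto_atTop
    exact tendsto_atTop_add_const_right _ _
      (tendsto_natCast_atTop_atTop.const_mul_atTop (by norm_num))
  have h := ((Real.continuousAt_const_rpow hCpos.ne').tendsto.comp hlim).mul
    ((Real.continuousAt_const_rpow hl0.ne').tendsto.comp
      (hlim.const_mul (1 / 3) |>.const_sub (1 / 3)))
  have h' := ge_of_tendsto' h hle
  simpa using h'

lemma sum_isOpenQuad (x y p q : ℝ) (a : Fin 4) :
    ∑ d, ∑ c, ∑ b, (if IsOpenQuad b c d a then
      stepWeight x y b * stepWeight x y c * stepWeight x y d * (![p, p, q, q] : Fin 4 → ℝ) b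
        else 0) =
    (![(x ^ 3 + 8 * x ^ 2 * y + 4 * x * y ^ 2) * p +
          (2 * x ^ 2 * y + 8 * x * y ^ 2 + 2 * y ^ 3) * q,
        (x ^ 3 + 8 * x ^ 2 * y + 4 * x * y ^ 2) * p +
          (2 * x ^ 2 * y + 8 * x * y ^ 2 + 2 * y ^ 3) * q,
        (2 * y ^ 2 * x + 8 * y * x ^ 2 + 2 * x ^ 3) * p +
          (y ^ 3 + 8 * y ^ 2 * x + 4 * y * x ^ 2) * q,
        (2 * y ^ 2 * x + 8 * y * x ^ 2 + 2 * x ^ 3) * p +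
          (y ^ 3 + 8 * y ^ 2 * x + 4 * y * x ^ 2) * q] : Fin 4 → ℝ) a := by
  fin_cases a <;> simp [Fin.sum_univ_four, IsOpenQuad, sqStep, stepWeight] <;> ring

theorem sawMu_le_bound_m1_n4 (x y : ℝ) (hx : 0 < x) (hy : 0 < y) :
    sawMu x y ≤ (2 : ℝ) ^ (-(1 / 3 : ℝ)) *
      (x ^ 3 + 12 * x * y * (x + y) + y ^ 3 +
        Real.sqrt (x ^ 6 + 24 * x ^ 5 * y + 136 * x ^ 4 * y ^ 2 + 254 * x ^ 3 * y ^ 3 +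
          136 * x ^ 2 * y ^ 4 + 24 * x * y ^ 5 + y ^ 6)) ^ (1 / 3 : ℝ) := by
  set D := x ^ 6 + 24 * x ^ 5 * y + 136 * x ^ 4 * y ^ 2 + 254 * x ^ 3 * y ^ 3 +
    136 * x ^ 2 * y ^ 4 + 24 * x * y ^ 5 + y ^ 6 with hD
  set A := x ^ 3 + 12 * x * y * (x + y) + y ^ 3 with hA
  set s := Real.sqrt D with hs
  have hs2 : s ^ 2 = D := Real.sq_sqrt (by positivity)
  have hs0 : 0 ≤ s := Real.sqrt_nonneg D
  have hA0 : 0 < A := by positivity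
  set a := x ^ 3 + 8 * x ^ 2 * y + 4 * x * y ^ 2 with ha
  set a' := y ^ 3 + 8 * y ^ 2 * x + 4 * y * x ^ 2 with ha'
  set b := 2 * x ^ 2 * y + 8 * x * y ^ 2 + 2 * y ^ 3 with hb
  set b' := 2 * y ^ 2 * x + 8 * y * x ^ 2 + 2 * x ^ 3 with hb'
  have hb0 : 0 < b := by positivity
  have hb0' : 0 < b' := by positivity
  have htrace : A = a + a' := by rw [hA, ha, ha']; ring
  have hdisc : D = (a - a') ^ 2 + 4 * (b * b') := by rw [hD, ha, ha', hb, hb']; ring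
  set l := (A + s) / 2 with hl
  have hq : 0 < l - a := by
    have : a - a' < s := by
      apply lt_of_pow_lt_pow_left₀ 2 hs0
      rw [hs2, hdisc]
      have := mul_pos hb0 hb0'
      linarith
    linarith
  have hl0 : 0 < l := by positivity
  have hchar : b' * b + a' * (l - a) = l * (l - a) := by
    rw [hl, htrace]
    linear_combination (-1 / 4 : ℝ) * (hs2.trans hdisc)
  have key : sawMu x y ≤ l ^ (1 / 3 : ℝ) := by
    refine sawMu_le_of_supersolution (f := ![b, b, l - a, l - a]) hx hy hl0 ?_ ?_
    · intro i
      fin_cases i <;> simp only [] <;> assumption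
    · intro i
      rw [sum_isOpenQuad, ← ha, ← ha', ← hb, ← hb']
      apply le_of_eq
      have h₁ : a * b + b * (l - a) = l * b := by ring
      fin_cases i <;> simp only [] <;> assumption
  refine key.trans_eq ?_
  rw [hl, div_eq_inv_mul, Real.mul_rpow (by norm_num) (by positivity), Real.inv_rpow (by norm_num),
    Real.rpow_neg (by norm_num)]
end

section
/- For all weights x, z > 0, the weighted connective constant of self-avoiding walks on the simple cubic lattice, with steps in the ±e₁ and ±e₂ directions weighted x and steps in the ±e₃ direction weighted z, satisfies μ₃(x,z) ≤ 2^{−1/2}·[9x² + 16xz + z² + (3x + z)·√(9x² + 26xz + z²)]^{1/2}. -/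
open scoped BigOperators

def cubeStep : Fin 6 → ℤ × ℤ × ℤ
  | 0 => (1, 0, 0)
  | 1 => (-1, 0, 0)
  | 2 => (0, 1, 0)
  | 3 => (0, -1, 0)
  | 4 => (0, 0, 1)
  | 5 => (0, 0, -1)

/-- Position of the walk after `i` steps, starting at the origin. -/
def cubePos {n : ℕ} (ω : Fin n → Fin 6) (i : Fin (n + 1)) : ℤ × ℤ × ℤ :=
  ∑ j : Fin n, if (j : ℕ) < (i : ℕ) then cubeStep (ω j) else 0

/-- Number of steps in the `±e₁` or `±e₂` directions. -/
def cubeNxy {n : ℕ} (ω : Fin n → Fin 6) : ℕ :=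
  (Finset.univ.filter fun j => ω j = 0 ∨ ω j = 1 ∨ ω j = 2 ∨ ω j = 3).card

/-- Number of steps in the `±e₃` directions. -/
def cubeNz {n : ℕ} (ω : Fin n → Fin 6) : ℕ :=
  (Finset.univ.filter fun j => ω j = 4 ∨ ω j = 5).card

/-- Weight `x^{N₁+N₂} z^{N₃}` of a walk. -/
noncomputable def cubeWeight (x z : ℝ) {n : ℕ} (ω : Fin n → Fin 6) : ℝ :=
  x ^ cubeNxy ω * z ^ cubeNz ω

/-- A walk is self-avoiding if its vertices are pairwise distinct. -/
def cubeIsSAW {n : ℕ} (ω : Fin n → Fin 6) : Prop :=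
  Function.Injective (cubePos ω)

/- `cubeSawCount n x z` is `c_n(x,z)`: the sum of the weights of all `n`-step
self-avoiding walks starting at the origin. -/
open Classical in
noncomputable def cubeSawCount (n : ℕ) (x z : ℝ) : ℝ :=
  ∑ ω ∈ Finset.univ.filter (fun ω : Fin n → Fin 6 => cubeIsSAW ω), cubeWeight x z ω

/-- The weighted connective constant `μ₃(x,z) = inf_{n ≥ 1} c_n(x,z)^{1/n}`. -/
noncomputable def cubeSawMu (x z : ℝ) : ℝ :=
  ⨅ n : ℕ, cubeSawCount (n + 1) x z ^ (1 / (n + 1 : ℝ))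

/-- Consecutive letters of the word `σ` are related by `R`. -/
def IsChainWord {α : Type*} (R : α → α → Prop) {n : ℕ} (σ : Fin (n + 1) → α) : Prop :=
  ∀ i : Fin n, R (σ i.castSucc) (σ i.succ)

theorem isChainWord_cons_cons {α : Type*} (R : α → α → Prop) {n : ℕ} (d e : α) (ω : Fin n → α) :
    IsChainWord R (Fin.cons d (Fin.cons e ω : Fin (n + 1) → α) : Fin (n + 2) → α) ↔
      R d e ∧ IsChainWord R (Fin.cons e ω : Fin (n + 1) → α) := by
  simp [IsChainWord, Fin.forall_fin_succ (n := n)]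

/-- Summation over nonempty words by first letter. -/
theorem sum_words_succ {α : Type*} [Fintype α] {n : ℕ} (f : (Fin (n + 1) → α) → ℝ) :
    ∑ σ, f σ = ∑ e : α, ∑ ω : Fin n → α, f (Fin.cons e ω) := by
  rw [← (Fin.consEquiv fun _ : Fin (n + 1) => α).sum_comp, Fintype.sum_prod_type]
  rfl

open Classical in
/-- Transfer-matrix bound: a positive superharmonic vector `h` controls the weighted number of
chain words with a given first letter. -/
theorem mul_sum_chainWord_le {α : Type*} [Fintype α] (R : α → α → Prop) (w h : α → ℝ) (c l : ℝ)
    (hw : ∀ d, 0 ≤ w d) (hl : 0 ≤ l) (hc : ∀ d, c ≤ h d)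
    (hh : ∀ d, ∑ e, (if R d e then w e * h e else 0) ≤ l * h d) (n : ℕ) (d : α) :
    c * ∑ ω : Fin n → α, (if IsChainWord R (Fin.cons d ω : Fin (n + 1) → α)
      then ∏ i, w (ω i) else 0) ≤ l ^ n * h d := by
  induction n generalizing d with
  | zero => simpa [IsChainWord] using hc d
  | succ n ih =>
    rw [sum_words_succ, Finset.mul_sum]
    calc _ ≤ ∑ e, l ^ n * (if R d e then w e * h e else 0) := by
          refine Finset.sum_le_sum fun e _ => ?_
          simp only [isChainWord_cons_cons, Fin.prod_univ_succ, Fin.cons_zero, Fin.cons_succ]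
          by_cases hde : R d e
          · have := mul_le_mul_of_nonneg_left (ih e) (hw e)
            simp only [hde, true_and, if_true]
            simp only [← mul_ite_zero, ← Finset.mul_sum]
            linarith
          · simp [hde]
      _ ≤ l ^ (n + 1) * h d := by
          rw [← Finset.mul_sum, pow_succ, mul_assoc]
          exact mul_le_mul_of_nonneg_left (hh d) (pow_nonneg hl n)

/-- An exponential bound `a n ≤ C * l ^ n` bounds the infimum of the `n`-th roots by `l`. -/
theorem iInf_rpow_le_of_le_mul_pow (a : ℕ → ℝ) (C l : ℝ) (hC : 0 < C) (hl : 0 < l)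
    (ha : ∀ n, 0 ≤ a n) (h : ∀ n, a n ≤ C * l ^ n) :
    ⨅ n : ℕ, a (n + 1) ^ (1 / (n + 1 : ℝ)) ≤ l := by
  have hlim : Filter.Tendsto (fun n : ℕ => C ^ (1 / (n + 1 : ℝ)) * l) Filter.atTop (nhds l) := by
    simpa using ((Real.continuousAt_const_rpow hC.ne').tendsto.comp
      (tendsto_one_div_add_atTop_nhds_zero_nat (𝕜 := ℝ))).mul_const l
  refine ge_of_tendsto' hlim fun n => ?_
  have hbdd : BddBelow (Set.range fun n : ℕ => a (n + 1) ^ (1 / (n + 1 : ℝ))) :=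
    ⟨0, by rintro _ ⟨k, rfl⟩; exact Real.rpow_nonneg (ha _) _⟩
  refine (ciInf_le hbdd n).trans ?_
  calc a (n + 1) ^ (1 / (n + 1 : ℝ)) ≤ (C * l ^ (n + 1)) ^ (1 / (n + 1 : ℝ)) :=
        Real.rpow_le_rpow (ha _) (h _) (by positivity)
    _ = C ^ (1 / (n + 1 : ℝ)) * l := by
        rw [Real.mul_rpow hC.le (by positivity), one_div]
        congr 1
        exact_mod_cast Real.pow_rpow_inv_natCast hl.le (Nat.succ_ne_zero n)

theorem cubePos_succ {n : ℕ} (ω : Fin n → Fin 6) (k : Fin n) :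
    cubePos ω k.succ = cubePos ω k.castSucc + cubeStep (ω k) := by
  have hk : cubeStep (ω k) = ∑ j : Fin n, if j = k then cubeStep (ω j) else 0 := by simp
  rw [hk, cubePos, cubePos, ← Finset.sum_add_distrib]
  refine Finset.sum_congr rfl fun j _ => ?_
  simp only [Fin.val_succ, Fin.val_castSucc, Fin.ext_iff]
  rcases lt_trichotomy (j : ℕ) k with h | h | h
  · simp [h, h.ne, h.trans (Nat.lt_succ_self _)]
  · simp [h]
  · simp [h.ne', h.le.not_gt, (Nat.succ_le_of_lt h).not_gt]

/-- A self-avoiding walk never reverses a step immediately. -/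
theorem cubeIsSAW.isChainWord {n : ℕ} {σ : Fin (n + 1) → Fin 6} (h : cubeIsSAW σ) :
    IsChainWord (fun d e => cubeStep d + cubeStep e ≠ 0) σ := by
  intro i hi
  have hpos : cubePos σ i.succ.succ = cubePos σ i.castSucc.castSucc := by
    rw [cubePos_succ, ← Fin.succ_castSucc, cubePos_succ, add_assoc, hi, add_zero]
  have := congrArg Fin.val (h hpos)
  simp only [Fin.val_succ, Fin.val_castSucc] at this
  omega

/-- The weight of a single step. -/
noncomputable def cubeStepWeight (x z : ℝ) (d : Fin 6) : ℝ :=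
  if d = 4 ∨ d = 5 then z else x

theorem cubeStepWeight_pos {x z : ℝ} (hx : 0 < x) (hz : 0 < z) (d : Fin 6) :
    0 < cubeStepWeight x z d := by
  unfold cubeStepWeight
  split_ifs <;> assumption

theorem cubeWeight_eq_prod (x z : ℝ) {n : ℕ} (ω : Fin n → Fin 6) :
    cubeWeight x z ω = ∏ i, cubeStepWeight x z (ω i) := by
  have hdir : ∀ d : Fin 6, (d = 0 ∨ d = 1 ∨ d = 2 ∨ d = 3) ↔ ¬(d = 4 ∨ d = 5) := by decide
  simp only [cubeStepWeight, Finset.prod_ite, Finset.prod_const, cubeWeight, cubeNxy, cubeNz, hdir]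
  exact mul_comm _ _

theorem cubeSawCount_nonneg {x z : ℝ} (hx : 0 < x) (hz : 0 < z) (n : ℕ) :
    0 ≤ cubeSawCount n x z :=
  Finset.sum_nonneg fun _ _ => by unfold cubeWeight; positivity

open Classical in
/-- Self-avoiding walks are dominated by walks without immediate reversals. -/
theorem cubeSawCount_succ_le {x z : ℝ} (hx : 0 < x) (hz : 0 < z) (n : ℕ) :
    cubeSawCount (n + 1) x z ≤ ∑ e, cubeStepWeight x z e * ∑ ω : Fin n → Fin 6,
      (if IsChainWord (fun d e => cubeStep d + cubeStep e ≠ 0)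
          (Fin.cons e ω : Fin (n + 1) → Fin 6)
        then ∏ i, cubeStepWeight x z (ω i) else 0) := by
  rw [cubeSawCount, Finset.sum_filter, sum_words_succ]
  refine Finset.sum_le_sum fun e _ => ?_
  rw [Finset.mul_sum]
  refine Finset.sum_le_sum fun ω _ => ?_
  have hprod : 0 ≤ ∏ i, cubeStepWeight x z (ω i) :=
    Finset.prod_nonneg fun i _ => (cubeStepWeight_pos hx hz _).le
  have he := (cubeStepWeight_pos hx hz e).le
  by_cases h : cubeIsSAW (Fin.cons e ω : Fin (n + 1) → Fin 6)
  · simp [h, h.isChainWord, cubeWeight_eq_prod, Fin.prod_univ_succ]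
  · rw [if_neg h]
    split_ifs <;> positivity

/-- The connective constant is at most any `l > z` satisfying the characteristic equation of
the transfer matrix for walks without immediate reversals. -/
theorem cubeSawMu_le_of_characteristic {x z l : ℝ} (hx : 0 < x) (hz : 0 < z) (hzl : z < l)
    (hl : l ^ 2 = (3 * x + z) * l + 5 * x * z) : cubeSawMu x z ≤ l := by
  classical
  have hl0 : 0 < l := hz.trans hzl
  set w := cubeStepWeight x z with hw
  set h : Fin 6 → ℝ := fun d => if d = 4 ∨ d = 5 then 4 * x else l - z with hh
  set c := min (4 * x) (l - z) with hc
  have hc0 : 0 < c := lt_min (by positivity) (sub_pos.2 hzl)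
  have hch : ∀ d, c ≤ h d := fun d => by
    simp only [hh]
    split_ifs
    exacts [min_le_left _ _, min_le_right _ _]
  have hwp : ∀ d, 0 < w d := cubeStepWeight_pos hx hz
  have hharm : ∀ d, ∑ e, (if cubeStep d + cubeStep e ≠ 0 then w e * h e else 0) ≤ l * h d := by
    intro d
    fin_cases d <;>
      simp [Fin.sum_univ_six, cubeStep, hw, hh, cubeStepWeight, Fin.ext_iff] <;> linarith
  set C := ∑ e, w e * (h e / c) with hC
  have hC0 : 0 < C := Finset.sum_pos
    (fun e _ => mul_pos (hwp e) (div_pos (hc0.trans_le (hch e)) hc0)) Finset.univ_nonempty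
  have hbound : ∀ n, cubeSawCount (n + 1) x z ≤ C * l ^ n := fun n => by
    refine (cubeSawCount_succ_le hx hz n).trans ?_
    rw [hC, Finset.sum_mul]
    refine Finset.sum_le_sum fun e _ => ?_
    rw [mul_assoc]
    refine mul_le_mul_of_nonneg_left ?_ (hwp e).le
    rw [div_mul_eq_mul_div, le_div_iff₀ hc0, mul_comm, mul_comm (h e)]
    exact mul_sum_chainWord_le _ w h c l (fun d => (hwp d).le) hl0.le hch
      (fun d => by convert hharm d) n e
  have hzero : cubeSawCount 0 x z ≤ 1 := by
    rw [cubeSawCount, Finset.sum_filter]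
    simp only [Fintype.sum_unique, cubeWeight_eq_prod, Finset.univ_eq_empty, Finset.prod_empty]
    split_ifs <;> norm_num
  refine iInf_rpow_le_of_le_mul_pow (fun n => cubeSawCount n x z) (1 + C / l) l (by positivity)
    hl0 (cubeSawCount_nonneg hx hz) fun n => ?_
  cases n with
  | zero =>
    have : 0 < C / l := by positivity
    simp only [pow_zero]
    linarith
  | succ n =>
    have : C * l ^ n = C / l * l ^ (n + 1) := by
      rw [pow_succ]
      field_simp
    have := hbound n
    have : 0 < l ^ (n + 1) := by positivity
    linarith

theorem cubeSawMu_le_bound_m1_n3 (x z : ℝ) (hx : 0 < x) (hz : 0 < z) :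
    cubeSawMu x z ≤ (2 : ℝ) ^ (-(1 / 2 : ℝ)) *
      (9 * x ^ 2 + 16 * x * z + z ^ 2 +
        (3 * x + z) * Real.sqrt (9 * x ^ 2 + 26 * x * z + z ^ 2)) ^ (1 / 2 : ℝ) := by
  set s := Real.sqrt (9 * x ^ 2 + 26 * x * z + z ^ 2) with hs
  have hs2 : s ^ 2 = 9 * x ^ 2 + 26 * x * z + z ^ 2 := Real.sq_sqrt (by positivity)
  have hzs : z < s := Real.lt_sqrt_of_sq_lt (by nlinarith [mul_pos hx hz, sq_pos_of_pos hx])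
  have hrhs : (2 : ℝ) ^ (-(1 / 2 : ℝ)) *
      (9 * x ^ 2 + 16 * x * z + z ^ 2 + (3 * x + z) * s) ^ (1 / 2 : ℝ) = (3 * x + z + s) / 2 := by
    have hs0 : 0 < s := hz.trans hzs
    rw [Real.rpow_neg two_pos.le, ← Real.inv_rpow two_pos.le,
      ← Real.mul_rpow (by norm_num) (by positivity), ← Real.sqrt_eq_rpow,
      Real.sqrt_eq_iff_mul_self_eq_of_pos (by positivity)]
    linarith
  rw [hrhs]
  exact cubeSawMu_le_of_characteristic hx hz (by linarith) (by linarith)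
end
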